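/- arXiv:2502.06740 — 9 statements merged into one kernel-verified Lean document; each statement's English description precedes it below -/
import Mathlib

section
/- Let n, m ∈ ℕ and p ∈ ℚ[X_{n,m}]. Then p is Sym_n × Sym_m-symmetric if and only if p lies in the ℚ-linear span of the set of homomorphism polynomials {hom_{F,n,m} : F a bipartite multigraph}; that is, p is fixed by all variable renamings x_{ij} ↦ x_{π(i)σ(j)} if and only if p is a finite ℚ-linear combination of homomorphism polynomials of bipartite multigraphs. -/
open MvPolynomial Finset

/-- The homomorphism polynomial `hom_{F,n,m}` of a bipartite multigraph `F` with side
sizes `α`, `β` and edge multiplicities `E`. -/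
noncomputable def homPoly (n m α β : ℕ) (E : Fin α × Fin β → ℕ) :
    MvPolynomial (Fin n × Fin m) ℚ :=
  ∑ f : Fin α → Fin n, ∑ g : Fin β → Fin m,
    ∏ p : Fin α × Fin β, (X (f p.1, g p.2) : MvPolynomial (Fin n × Fin m) ℚ) ^ E p

/-- A sum over the permutations of a finite type lies in a submodule as soon as every sum over
the functions factoring through a fixed map does. -/
theorem sum_perm_mem_of_forall_sum_comp_mem {N V : Type*} [Fintype N] [DecidableEq N]
    [AddCommGroup V] [Module ℚ V] (W : Submodule ℚ V) (h : (N → N) → V)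
    (hW : ∀ (k : ℕ) (a : N → Fin k), ∑ f : Fin k → N, h (f ∘ a) ∈ W) :
    ∑ π : Equiv.Perm N, h π ∈ W := by
  classical
  have key := inclusion_exclusion_sum_inf_compl (univ : Finset N).offDiag
    (fun p => univ.filter fun f : N → N => f p.1 = f p.2) h
  have hperm : ∑ π : Equiv.Perm N, h π =
      ∑ f ∈ (univ : Finset N).offDiag.inf
        (fun p => (univ.filter fun f : N → N => f p.1 = f p.2)ᶜ), h f := by
    refine sum_bij (fun π _ => (π : N → N)) ?_ ?_ ?_ (fun _ _ => rfl)
    · intro π _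
      simp +contextual [Finset.mem_inf]
    · intro π _ σ _ e
      exact DFunLike.coe_injective e
    · intro f hf
      have hinj : Function.Injective f := by
        intro u v huv
        by_contra hne
        simp only [Finset.mem_inf] at hf
        simpa [huv] using hf (u, v) (by simpa using hne)
      exact ⟨Equiv.ofBijective f (Finite.injective_iff_bijective.mp hinj), mem_univ _, rfl⟩
  rw [hperm, key]
  refine W.sum_mem fun t _ => ?_
  rw [← Int.cast_smul_eq_zsmul ℚ]
  refine W.smul_mem _ ?_
  let r : N → N → Prop := fun u v => (u, v) ∈ t
  have : Fintype (Quot r) := Fintype.ofFinite _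
  let e := Fintype.equivFin (Quot r)
  convert hW _ (fun u => e (Quot.mk r u)) using 1
  symm
  refine sum_bij (fun f _ => f ∘ fun u => e (Quot.mk r u)) ?_ ?_ ?_ (fun _ _ => rfl)
  · intro f _
    simp only [Finset.mem_inf, mem_filter, mem_univ, true_and, Function.comp_apply]
    intro p hp
    rw [Quot.sound (r := r) (a := p.1) (b := p.2) hp]
  · intro f _ g _ hfg
    funext i
    obtain ⟨u, hu⟩ := Quot.exists_rep (e.symm i)
    simpa [hu] using congrFun hfg u
  · intro f hf
    simp only [Finset.mem_inf, mem_filter, mem_univ, true_and] at hf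
    exact ⟨fun i => Quot.lift f (fun u v huv => hf (u, v) huv) (e.symm i), mem_univ _, by
      funext u; simp⟩

/-- Substituting along vertex maps `a`, `b` in a homomorphism sum yields the homomorphism
polynomial of the pushed-forward multigraph. -/
theorem sum_prod_X_comp_eq_homPoly {A B : Type*} [Fintype A] [Fintype B] (n m k l : ℕ)
    (E : A × B → ℕ) (a : A → Fin k) (b : B → Fin l) :
    ∑ f : Fin k → Fin n, ∑ g : Fin l → Fin m,
      ∏ q : A × B, (X (f (a q.1), g (b q.2)) : MvPolynomial (Fin n × Fin m) ℚ) ^ E q =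
    homPoly n m k l
      (fun p => ∑ q : A × B with Prod.map a b q = p, E q) := by
  unfold homPoly
  refine sum_congr rfl fun f _ => sum_congr rfl fun g _ => ?_
  rw [← prod_fiberwise univ (Prod.map a b)]
  refine prod_congr rfl fun p _ => ?_
  rw [← prod_pow_eq_pow_sum]
  refine prod_congr rfl fun q hq => ?_
  rw [← (mem_filter.mp hq).2]
  rfl

theorem rename_homPoly (n m α β : ℕ) (E : Fin α × Fin β → ℕ) (π : Equiv.Perm (Fin n))
    (σ : Equiv.Perm (Fin m)) :
    rename (fun q : Fin n × Fin m => (π q.1, σ q.2)) (homPoly n m α β E) =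
      homPoly n m α β E := by
  simp only [homPoly, map_sum, map_prod, map_pow, rename_X]
  refine Fintype.sum_equiv (Equiv.arrowCongr (Equiv.refl _) π) _ _ fun f => ?_
  exact Fintype.sum_equiv (Equiv.arrowCongr (Equiv.refl _) σ) _ _ fun g => by simp

/-- Every symmetrization is a linear combination of homomorphism polynomials. -/
theorem sum_rename_mem_span_homPoly (n m : ℕ) (p : MvPolynomial (Fin n × Fin m) ℚ) :
    ∑ π : Equiv.Perm (Fin n), ∑ σ : Equiv.Perm (Fin m),
        rename (fun q : Fin n × Fin m => (π q.1, σ q.2)) p ∈ Submodule.span ℚ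
      {q : MvPolynomial (Fin n × Fin m) ℚ |
        ∃ (α β : ℕ) (E : Fin α × Fin β → ℕ), q = homPoly n m α β E} := by
  induction p using MvPolynomial.induction_on' with
  | add p q hp hq =>
    simp only [map_add, sum_add_distrib]
    exact Submodule.add_mem _ hp hq
  | monomial d c =>
    have hmon (π : Equiv.Perm (Fin n)) (σ : Equiv.Perm (Fin m)) :
        rename (fun q : Fin n × Fin m => (π q.1, σ q.2)) (monomial d c) =
          c • ∏ q : Fin n × Fin m,
            (X (π q.1, σ q.2) : MvPolynomial (Fin n × Fin m) ℚ) ^ d q := by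
      rw [monomial_eq, Finsupp.prod_fintype _ _ (by simp), ← smul_eq_C_mul]
      simp
    simp only [hmon, ← smul_sum]
    refine Submodule.smul_mem _ _ ?_
    refine sum_perm_mem_of_forall_sum_comp_mem _
      (fun f => ∑ σ : Equiv.Perm (Fin m), ∏ q : Fin n × Fin m, X (f q.1, σ q.2) ^ d q)
      fun k a => ?_
    rw [sum_comm]
    refine sum_perm_mem_of_forall_sum_comp_mem _
      (fun g => ∑ f : Fin k → Fin n, ∏ q : Fin n × Fin m, X ((f ∘ a) q.1, g q.2) ^ d q)
      fun l b => ?_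
    rw [sum_comm]
    exact Submodule.subset_span ⟨k, l, _, sum_prod_X_comp_eq_homPoly n m k l d a b⟩

/-- A polynomial `p ∈ ℚ[X_{n,m}]` is `Sym_n × Sym_m`-symmetric iff it lies in the
ℚ-linear span of the homomorphism polynomials of bipartite multigraphs. -/
theorem symmetric_iff_mem_span_homPoly (n m : ℕ) (p : MvPolynomial (Fin n × Fin m) ℚ) :
    (∀ (π : Equiv.Perm (Fin n)) (σ : Equiv.Perm (Fin m)),
        rename (fun q : Fin n × Fin m => (π q.1, σ q.2)) p = p) ↔
      p ∈ Submodule.span ℚ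
        {q : MvPolynomial (Fin n × Fin m) ℚ |
          ∃ (α β : ℕ) (E : Fin α × Fin β → ℕ), q = homPoly n m α β E} := by
  constructor
  · intro h
    have hp := sum_rename_mem_span_homPoly n m p
    simp only [h, sum_const, card_univ, ← Nat.cast_smul_eq_nsmul ℚ] at hp
    rwa [Submodule.smul_mem_iff _ (by simp [Fintype.card_ne_zero]),
      Submodule.smul_mem_iff _ (by simp [Fintype.card_ne_zero])] at hp
  · intro hp π σ
    induction hp using Submodule.span_induction with
    | mem q hq =>
      obtain ⟨α, β, E, rfl⟩ := hq
      exact rename_homPoly n m α β E π σ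
    | zero => exact map_zero _
    | add q r _ _ hq hr => rw [map_add, hq, hr]
    | smul c q _ hq => rw [map_smul, hq]
end

section
/- Let n, m ∈ ℕ and p ∈ ℚ[X_{n,m}]. Then p is Sym_n × Sym_m-symmetric if and only if p lies in the ℚ-linear span of the set of embedding polynomials {emb_{F,n,m} : F a bipartite multigraph} (equivalently, of the subgraph polynomials sub_{F,n,m} = emb_{F,n,m}/|Aut(F)|, since these span the same ℚ-subspace). -/
open MvPolynomial Finset

/-- The embedding polynomial `emb_{F,n,m}` of a bipartite multigraph `F` with side
sizes `α`, `β` and edge multiplicities `E`: the sums range over injective maps. -/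
noncomputable def embPoly (n m α β : ℕ) (E : Fin α × Fin β → ℕ) :
    MvPolynomial (Fin n × Fin m) ℚ :=
  ∑ f : Fin α ↪ Fin n, ∑ g : Fin β ↪ Fin m,
    ∏ p : Fin α × Fin β, (X (f p.1, g p.2) : MvPolynomial (Fin n × Fin m) ℚ) ^ E p

theorem rename_embPoly {n m : ℕ} (α β : ℕ) (E : Fin α × Fin β → ℕ)
    (π : Equiv.Perm (Fin n)) (σ : Equiv.Perm (Fin m)) :
    rename (fun q : Fin n × Fin m => (π q.1, σ q.2)) (embPoly n m α β E) =
      embPoly n m α β E := by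
  simp only [embPoly, map_sum, map_prod, map_pow, rename_X]
  refine Fintype.sum_equiv (Equiv.embeddingCongr (Equiv.refl _) π) _ _ fun f => ?_
  exact Fintype.sum_equiv (Equiv.embeddingCongr (Equiv.refl _) σ) _ _ fun g => rfl

theorem sum_rename_monomial (n m : ℕ) (s : Fin n × Fin m →₀ ℕ) (c : ℚ) :
    ∑ π : Equiv.Perm (Fin n), ∑ σ : Equiv.Perm (Fin m),
      rename (fun q : Fin n × Fin m => (π q.1, σ q.2)) (monomial s c) =
        c • embPoly n m n m s := by
  simp only [embPoly, smul_sum]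
  refine Fintype.sum_equiv (Equiv.embeddingEquivOfFinite _).symm _ _ fun π => ?_
  refine Fintype.sum_equiv (Equiv.embeddingEquivOfFinite _).symm _ _ fun σ => ?_
  rw [monomial_eq, Finsupp.prod_fintype _ _ fun _ => pow_zero _]
  simp only [map_mul, rename_C, map_prod, map_pow, rename_X, smul_eq_C_mul]
  rfl

theorem sum_rename_mem_span_embPoly (n m : ℕ) (p : MvPolynomial (Fin n × Fin m) ℚ) :
    ∑ π : Equiv.Perm (Fin n), ∑ σ : Equiv.Perm (Fin m),
      rename (fun q : Fin n × Fin m => (π q.1, σ q.2)) p ∈ Submodule.span ℚ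
        {q : MvPolynomial (Fin n × Fin m) ℚ |
          ∃ (α β : ℕ) (E : Fin α × Fin β → ℕ), q = embPoly n m α β E} := by
  induction p using MvPolynomial.induction_on' with
  | monomial s c =>
    rw [sum_rename_monomial]
    exact Submodule.smul_mem _ _ (Submodule.subset_span ⟨n, m, s, rfl⟩)
  | add p q hp hq =>
    simp only [map_add, sum_add_distrib]
    exact Submodule.add_mem _ hp hq

/-- A polynomial `p ∈ ℚ[X_{n,m}]` is `Sym_n × Sym_m`-symmetric iff it lies in the
ℚ-linear span of the embedding polynomials of bipartite multigraphs. -/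
theorem symmetric_iff_mem_span_embPoly (n m : ℕ) (p : MvPolynomial (Fin n × Fin m) ℚ) :
    (∀ (π : Equiv.Perm (Fin n)) (σ : Equiv.Perm (Fin m)),
        rename (fun q : Fin n × Fin m => (π q.1, σ q.2)) p = p) ↔
      p ∈ Submodule.span ℚ
        {q : MvPolynomial (Fin n × Fin m) ℚ |
          ∃ (α β : ℕ) (E : Fin α × Fin β → ℕ), q = embPoly n m α β E} := by
  constructor
  · intro h
    have hmem := sum_rename_mem_span_embPoly n m p
    simp only [h, sum_const, ← Nat.cast_smul_eq_nsmul ℚ] at hmem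
    rwa [Submodule.smul_mem_iff _ (by simp), Submodule.smul_mem_iff _ (by simp)] at hmem
  · intro h π σ
    induction h using Submodule.span_induction with
    | mem q hq =>
      obtain ⟨α, β, E, rfl⟩ := hq
      exact rename_embPoly α β E π σ
    | zero => exact map_zero _
    | add q r _ _ hq hr => rw [map_add, hq, hr]
    | smul c q _ hq => rw [map_smul, hq]
end

section
/- Let K be a field, A a commutative K-algebra, and t, n ∈ ℕ with n ≥ 1. Let p ∈ MvPolynomial (Fin t) A be such that the degree of p in each variable is less than n, and let a : Fin n → K be injective (i.e., a₁, …, a_n are distinct elements of K). Then for every exponent vector d : Fin t →₀ ℕ, the coefficient of the monomial x^d in p lies in the K-submodule of A spanned by the n^t evaluations of p at the grid points, namely the values eval (fun i ↦ algebraMap K A (a (j i))) p for j : Fin t → Fin n. -/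
open MvPolynomial

/-- The coefficient functionals of polynomials of degree less than `n` are linear combinations of
evaluations at `n` distinct nodes. -/
theorem exists_sum_mul_pow_eq_ite {K : Type*} [Field K] {n : ℕ} {a : Fin n → K}
    (ha : Function.Injective a) :
    ∃ w : Fin n → Fin n → K, ∀ m e : Fin n,
      ∑ k, w m k * a k ^ (e : ℕ) = if m = e then 1 else 0 := by
  have h : IsUnit (Matrix.vandermonde a).det :=
    (Matrix.det_vandermonde_ne_zero_iff.mpr ha).isUnit
  refine ⟨((Matrix.vandermonde a)⁻¹ : Matrix (Fin n) (Fin n) K), fun m e => ?_⟩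
  rw [← Matrix.one_apply, ← Matrix.nonsing_inv_mul _ h, Matrix.mul_apply]
  rfl

/-- Evaluation at a point with coordinates in the base field, as a linear combination of the
coefficients. -/
theorem MvPolynomial.eval_algebraMap_eq_sum_smul {K A σ : Type*} [CommSemiring K]
    [CommSemiring A] [Algebra K A] [Fintype σ] (x : σ → K) (p : MvPolynomial σ A) :
    eval (fun i => algebraMap K A (x i)) p =
      ∑ e ∈ p.support, (∏ i, x i ^ e i) • coeff e p := by
  rw [eval_eq']
  refine Finset.sum_congr rfl fun e _ => ?_
  rw [Algebra.smul_def, map_prod, mul_comm]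
  simp_rw [map_pow]

/-- Multivariate polynomial interpolation: if `p` is a polynomial over a commutative
`K`-algebra `A` in `t` variables whose degree in each variable is less than `n`, and
`a : Fin n → K` are distinct scalars, then every coefficient of `p` lies in the
`K`-submodule of `A` spanned by the `n^t` evaluations of `p` at the grid points. -/
theorem coeff_mem_span_grid_evals {K A : Type*} [Field K] [CommRing A] [Algebra K A]
    (t n : ℕ) (hn : 1 ≤ n) (p : MvPolynomial (Fin t) A)
    (hdeg : ∀ i : Fin t, p.degreeOf i < n)
    (a : Fin n → K) (ha : Function.Injective a) (d : Fin t →₀ ℕ) :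
    coeff d p ∈ Submodule.span K
      {y : A | ∃ j : Fin t → Fin n,
        y = eval (fun i : Fin t => algebraMap K A (a (j i))) p} := by
  by_cases hd : d ∈ p.support
  swap
  · rw [notMem_support_iff.mp hd]
    exact Submodule.zero_mem _
  have hlt : ∀ e ∈ p.support, ∀ i, e i < n := fun e he i =>
    (degreeOf_lt_iff (hn.trans_lt' Nat.zero_lt_one)).mp (hdeg i) e he
  obtain ⟨w, hw⟩ := exists_sum_mul_pow_eq_ite ha
  have key : coeff d p = ∑ j : Fin t → Fin n,
      (∏ i, w ⟨d i, hlt d hd i⟩ (j i)) •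
        eval (fun i => algebraMap K A (a (j i))) p := by
    simp_rw [eval_algebraMap_eq_sum_smul, Finset.smul_sum, smul_smul, ← Finset.prod_mul_distrib]
    rw [Finset.sum_comm]
    simp_rw [← Finset.sum_smul]
    rw [Finset.sum_eq_single_of_mem d hd]
    · rw [← Fintype.prod_sum fun i k => w ⟨d i, hlt d hd i⟩ k * a k ^ d i,
        Finset.prod_eq_one fun i _ => (hw ⟨d i, hlt d hd i⟩ ⟨d i, hlt d hd i⟩).trans (if_pos rfl),
        one_smul]
    · intro e he hed
      obtain ⟨i, hi⟩ := DFunLike.ne_iff.mp hed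
      rw [← Fintype.prod_sum fun i k => w ⟨d i, hlt d hd i⟩ k * a k ^ e i,
        Finset.prod_eq_zero (Finset.mem_univ i), zero_smul]
      exact (hw ⟨d i, hlt d hd i⟩ ⟨e i, hlt e he i⟩).trans
        (if_neg fun h => hi (Fin.mk.inj h).symm)
  rw [key]
  exact Submodule.sum_mem _ fun j _ =>
    Submodule.smul_mem _ _ (Submodule.subset_span ⟨j, rfl⟩)
end

section
/- Let n ∈ ℕ and let Δ be a subgroup of Sym(Fin n) = Equiv.Perm (Fin n). Call a finite set S ⊆ Fin n a support of Δ if every permutation that fixes every element of S belongs to Δ. Suppose Δ has a support S with 2·|S| < n. Then there exists a support S₀ of Δ with 2·|S₀| < n such that: (a) S₀ ⊆ S for every support S of Δ with 2·|S| < n (so S₀ is the unique minimal support of Δ among supports of size less than n/2); and (b) every element of Δ maps S₀ onto S₀ setwise, i.e. the pointwise stabiliser of S₀ is contained in Δ and Δ is contained in the setwise stabiliser of S₀. -/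
open Finset

/-- `S` is a support of the subgroup `Δ ≤ Sym(Fin n)`: every permutation fixing every
element of `S` pointwise belongs to `Δ`. -/
def IsSupport (n : ℕ) (Δ : Subgroup (Equiv.Perm (Fin n))) (S : Finset (Fin n)) : Prop :=
  ∀ π : Equiv.Perm (Fin n), (∀ s ∈ S, π s = s) → π ∈ Δ

/-- If every transposition of two points outside `S` lies in `Δ`, then `S` is a support. -/
theorem isSupport_of_swap_mem {n : ℕ} {Δ : Subgroup (Equiv.Perm (Fin n))} {S : Finset (Fin n)}
    (hswap : ∀ a ∉ S, ∀ b ∉ S, Equiv.swap a b ∈ Δ) : IsSupport n Δ S := by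
  intro π hπ
  have hmem (σ : Equiv.Perm {x // x ∉ S}) : Equiv.Perm.ofSubtype σ ∈ Δ := by
    induction σ using Equiv.Perm.swap_induction_on with
    | one => simp
    | swap_mul f x y _ ih =>
      rw [map_mul, Equiv.Perm.ofSubtype_swap_eq]
      exact Δ.mul_mem (hswap _ x.2 _ y.2) ih
  have hmaps (x : Fin n) : π x ∉ S ↔ x ∉ S := by
    refine not_congr ⟨fun hx => ?_, fun hx => (hπ x hx).symm ▸ hx⟩
    rwa [← π.injective (hπ _ hx)]
  rw [← Equiv.Perm.ofSubtype_subtypePerm (p := (· ∉ S)) hmaps fun x hx hxS => hx (hπ x hxS)]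
  exact hmem _

namespace IsSupport

variable {n : ℕ} {Δ : Subgroup (Equiv.Perm (Fin n))} {S T : Finset (Fin n)}

theorem swap_mem (hS : IsSupport n Δ S) {a b : Fin n} (ha : a ∉ S) (hb : b ∉ S) :
    Equiv.swap a b ∈ Δ :=
  hS _ fun _ hs => Equiv.swap_apply_of_ne_of_ne
    (ne_of_mem_of_not_mem hs ha) (ne_of_mem_of_not_mem hs hb)

/-- Two supports that do not cover `Fin n` have an intersection which is again a support. -/
theorem inter (hS : IsSupport n Δ S) (hT : IsSupport n Δ T) {c : Fin n} (hc : c ∉ S ∪ T) :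
    IsSupport n Δ (S ∩ T) := by
  obtain ⟨hcS, hcT⟩ := notMem_union.mp hc
  have hswap (a : Fin n) (ha : a ∉ S ∩ T) : Equiv.swap a c ∈ Δ := by
    by_cases haS : a ∈ S
    · exact hT.swap_mem (fun haT => ha (mem_inter.mpr ⟨haS, haT⟩)) hcT
    · exact hS.swap_mem haS hcS
  refine isSupport_of_swap_mem fun a ha b hb => ?_
  exact SubmonoidClass.swap_mem_trans Δ (hswap a ha) (Equiv.swap_comm b c ▸ hswap b hb)

/-- The image of a support of `Δ` under an element of `Δ` is a support of `Δ`. -/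
theorem image (hS : IsSupport n Δ S) {π : Equiv.Perm (Fin n)} (hπ : π ∈ Δ) :
    IsSupport n Δ (S.image π) := by
  intro σ hσ
  have hconj : π⁻¹ * σ * π ∈ Δ := hS _ fun s hs => by
    simp [hσ (π s) (mem_image_of_mem π hs)]
  simpa [mul_assoc] using Δ.mul_mem (Δ.mul_mem hπ hconj) (Δ.inv_mem hπ)

end IsSupport

/-- If a subgroup `Δ ≤ Sym(Fin n)` has a support of size less than `n/2`, then it has a
unique minimal such support `S₀`: `S₀` is contained in every support of size less than
`n/2`, and `Δ` stabilises `S₀` setwise. -/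
theorem exists_unique_minimal_support (n : ℕ) (Δ : Subgroup (Equiv.Perm (Fin n)))
    (h : ∃ S : Finset (Fin n), IsSupport n Δ S ∧ 2 * S.card < n) :
    ∃ S₀ : Finset (Fin n), IsSupport n Δ S₀ ∧ 2 * S₀.card < n ∧
      (∀ S : Finset (Fin n), IsSupport n Δ S → 2 * S.card < n → S₀ ⊆ S) ∧
      (∀ π ∈ Δ, S₀.image π = S₀) := by
  classical
  obtain ⟨S₀, hS₀, hmin⟩ := exists_min_image
    (univ.filter fun S => IsSupport n Δ S ∧ 2 * S.card < n) card
    (by simpa [Finset.Nonempty] using h)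
  simp only [mem_filter, mem_univ, true_and] at hS₀ hmin
  obtain ⟨hsupp, hcard⟩ := hS₀
  have hsub (S : Finset (Fin n)) (hS : IsSupport n Δ S) (hSn : 2 * S.card < n) : S₀ ⊆ S := by
    obtain ⟨c, hc⟩ : ∃ c, c ∉ S₀ ∪ S := by
      by_contra! hall
      have hle := card_union_le S₀ S
      rw [eq_univ_of_forall hall, card_fin] at hle
      omega
    have hle : (S₀ ∩ S).card ≤ S₀.card := card_le_card inter_subset_left
    exact inter_eq_left.mp <|
      eq_of_subset_of_card_le inter_subset_left (hmin _ ⟨hsupp.inter hS hc, by omega⟩)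
  refine ⟨S₀, hsupp, hcard, hsub, fun π hπ => ?_⟩
  have himage : (S₀.image π).card = S₀.card := card_image_of_injective S₀ π.injective
  exact (eq_of_subset_of_card_le (hsub _ (hsupp.image hπ) (himage ▸ hcard)) himage.le).symm
end

section
/- Every weak oddomorphism φ : F →g G between finite simple graphs is surjective on vertices and on edges: every v ∈ V(G) lies in the image of φ, and for every edge uv ∈ E(G) there exist adjacent vertices a, b ∈ V(F) with φ(a) = u and φ(b) = v. -/
/-- A vertex `a` of `F` is `φ`-odd: for every neighbour `v` of `φ a` in `G`, the number
of neighbours of `a` in the fibre `φ⁻¹(v)` is odd. -/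
def IsOddVertex {V W : Type*} (F : SimpleGraph V) (G : SimpleGraph W) (φ : F →g G)
    (a : V) : Prop :=
  ∀ v : W, G.Adj (φ a) v → Odd ({b : V | F.Adj a b ∧ φ b = v}.ncard)

/-- A vertex `a` of `F` is `φ`-even: for every neighbour `v` of `φ a` in `G`, the number
of neighbours of `a` in the fibre `φ⁻¹(v)` is even. -/
def IsEvenVertex {V W : Type*} (F : SimpleGraph V) (G : SimpleGraph W) (φ : F →g G)
    (a : V) : Prop :=
  ∀ v : W, G.Adj (φ a) v → Even ({b : V | F.Adj a b ∧ φ b = v}.ncard)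

/-- `φ` is an oddomorphism: every vertex is `φ`-odd or `φ`-even, and every fibre
contains an odd number of `φ`-odd vertices. -/
def IsOddomorphism {V W : Type*} (F : SimpleGraph V) (G : SimpleGraph W)
    (φ : F →g G) : Prop :=
  (∀ a : V, IsOddVertex F G φ a ∨ IsEvenVertex F G φ a) ∧
    ∀ v : W, Odd ({a : V | φ a = v ∧ IsOddVertex F G φ a}.ncard)

/-- `φ` is a weak oddomorphism: its restriction to some subgraph of `F` is an
oddomorphism. -/
def IsWeakOddomorphism {V W : Type*} (F : SimpleGraph V) (G : SimpleGraph W)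
    (φ : F →g G) : Prop :=
  ∃ F' : F.Subgraph, IsOddomorphism F'.coe G (φ.comp F'.hom)

/-- An oddomorphism has a vertex satisfying the oddness condition in every fibre. -/
theorem IsOddomorphism.exists_isOddVertex {V W : Type*} {F : SimpleGraph V}
    {G : SimpleGraph W} {φ : F →g G} (h : IsOddomorphism F G φ) (v : W) :
    ∃ a, φ a = v ∧ IsOddVertex F G φ a :=
  Set.nonempty_of_ncard_ne_zero (h.2 v).pos.ne'

/-- Every edge of the codomain lifts along an oddomorphism. -/
theorem IsOddomorphism.exists_adj {V W : Type*} {F : SimpleGraph V}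
    {G : SimpleGraph W} {φ : F →g G} (h : IsOddomorphism F G φ) {u v : W}
    (huv : G.Adj u v) : ∃ a b, F.Adj a b ∧ φ a = u ∧ φ b = v := by
  obtain ⟨a, rfl, ha⟩ := h.exists_isOddVertex u
  obtain ⟨b, hab, hb⟩ := Set.nonempty_of_ncard_ne_zero (ha v huv).pos.ne'
  exact ⟨a, b, hab, rfl, hb⟩

/-- Every weak oddomorphism between finite simple graphs is surjective on vertices and
on edges. -/
theorem isWeakOddomorphism_surjective {V W : Type*} [Fintype V] [Fintype W]
    (F : SimpleGraph V) (G : SimpleGraph W) (φ : F →g G)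
    (h : IsWeakOddomorphism F G φ) :
    Function.Surjective φ ∧
      ∀ u v : W, G.Adj u v → ∃ a b : V, F.Adj a b ∧ φ a = u ∧ φ b = v := by
  obtain ⟨F', hF'⟩ := h
  refine ⟨fun v => ?_, fun u v huv => ?_⟩
  · obtain ⟨a, ha, -⟩ := hF'.exists_isOddVertex v
    exact ⟨a, ha⟩
  · obtain ⟨a, b, hab, ha, hb⟩ := hF'.exists_adj huv
    exact ⟨a, b, F'.hom.map_adj hab, ha, hb⟩
end

section
/- Let 𝓕 be a class of finite simple bipartite graphs and let n ∈ ℕ. Let F be a finite simple bipartite graph with a bipartition (A, B) satisfying the following hypothesis (F_{A,B} ∈ cl^bip_{n,n}(𝓕)): for all finite simple bipartite graphs G and H, each equipped with a bipartition whose left side has size n and whose right side has size n, if for every F' ∈ 𝓕 and every bipartition (A', B') of F' the number of bipartition-respecting homomorphisms from F'_{A',B'} to G equals the corresponding number for H, then the number of bipartition-respecting homomorphisms from F_{A,B} to G equals that for H. Then F ∈ cl_n(𝓕): for all finite simple graphs G and H on exactly n vertices, if hom(F', G) = hom(F', H) for every F' ∈ 𝓕, then hom(F, G) = hom(F, H).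 -/
/-- `(A, B)` is a bipartition of the simple graph `F`: the two sets are disjoint, cover
all vertices, and every edge has one endpoint in `A` and one in `B`. -/
def IsBipartition {V : Type*} (F : SimpleGraph V) (A B : Set V) : Prop :=
  Disjoint A B ∧ A ∪ B = Set.univ ∧
    ∀ ⦃u v : V⦄, F.Adj u v → (u ∈ A ∧ v ∈ B) ∨ (u ∈ B ∧ v ∈ A)

/-- The total number of graph homomorphisms from `F` to `G`. -/
noncomputable def homCount {V W : Type*} (F : SimpleGraph V) (G : SimpleGraph W) : ℕ :=
  Nat.card (F →g G)

/-- The number of bipartition-respecting homomorphisms `h : F → G`, i.e. those with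
`h(A) ⊆ X` and `h(B) ⊆ Y`. -/
noncomputable def bipHomCount {V W : Type*} (F : SimpleGraph V) (A B : Set V)
    (G : SimpleGraph W) (X Y : Set W) : ℕ :=
  Nat.card {h : F →g G // (∀ a ∈ A, h a ∈ X) ∧ ∀ b ∈ B, h b ∈ Y}

/-- The bipartite double cover `G × K₂`, with vertex set transported to `Fin (2 * n)`. -/
def doubleCover {n : ℕ} (G : SimpleGraph (Fin n)) : SimpleGraph (Fin (2 * n)) where
  Adj u v := (finProdFinEquiv.symm u).1 ≠ (finProdFinEquiv.symm v).1 ∧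
    G.Adj (finProdFinEquiv.symm u).2 (finProdFinEquiv.symm v).2
  symm := ⟨fun _ _ h => ⟨h.1.symm, h.2.symm⟩⟩
  loopless := ⟨fun _ h => h.1 rfl⟩

/-- The `i`-th side of the bipartite double cover. -/
def doubleCoverSide (n : ℕ) (i : Fin 2) : Set (Fin (2 * n)) :=
  {v | (finProdFinEquiv.symm v).1 = i}

lemma mem_doubleCoverSide_iff {n : ℕ} {i j : Fin 2} {x : Fin n} :
    finProdFinEquiv (j, x) ∈ doubleCoverSide n i ↔ j = i := by
  change (finProdFinEquiv.symm (finProdFinEquiv (j, x))).1 = i ↔ j = i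
  rw [Equiv.symm_apply_apply]

lemma ncard_doubleCoverSide (n : ℕ) (i : Fin 2) : (doubleCoverSide n i).ncard = n := by
  have h : doubleCoverSide n i = Set.range fun x : Fin n => finProdFinEquiv (i, x) := by
    ext v
    constructor
    · rintro rfl
      exact ⟨(finProdFinEquiv.symm v).2, finProdFinEquiv.apply_symm_apply v⟩
    · rintro ⟨x, rfl⟩
      exact mem_doubleCoverSide_iff.2 rfl
  have hinj : Function.Injective fun x : Fin n => finProdFinEquiv (i, x) := fun x y hxy =>
    congrArg Prod.snd (finProdFinEquiv.injective hxy)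
  rw [h, ← Nat.card_coe_set_eq, Nat.card_range_of_injective hinj, Nat.card_fin]

lemma isBipartition_doubleCover {n : ℕ} (G : SimpleGraph (Fin n)) :
    IsBipartition (doubleCover G) (doubleCoverSide n 0) (doubleCoverSide n 1) := by
  refine ⟨?_, ?_, ?_⟩
  · rw [Set.disjoint_left]
    intro v h0 h1
    exact zero_ne_one (h0.symm.trans h1)
  · ext v
    have h : ∀ i : Fin 2, i = 0 ∨ i = 1 := by decide
    exact iff_of_true (h (finProdFinEquiv.symm v).1) (Set.mem_univ v)
  · rintro u v ⟨hne, -⟩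
    have h : ∀ i j : Fin 2, i ≠ j → (i = 0 ∧ j = 1) ∨ (i = 1 ∧ j = 0) := by decide
    exact h _ _ hne

open Classical in
/-- Bipartition-respecting homomorphisms into the bipartite double cover of `G` correspond to
homomorphisms into `G`. -/
noncomputable def homDoubleCoverEquiv {V : Type*} {F : SimpleGraph V} {A B : Set V}
    (hF : IsBipartition F A B) {n : ℕ} (G : SimpleGraph (Fin n)) :
    {h : F →g doubleCover G //
      (∀ a ∈ A, h a ∈ doubleCoverSide n 0) ∧ ∀ b ∈ B, h b ∈ doubleCoverSide n 1} ≃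
      (F →g G) where
  toFun h := ⟨fun v => (finProdFinEquiv.symm (h.1 v)).2, fun hadj => (h.1.map_adj hadj).2⟩
  invFun f :=
    ⟨⟨fun v => finProdFinEquiv (if v ∈ A then 0 else 1, f v), fun {u v} hadj => by
        have hdisj := Set.disjoint_left.1 hF.1
        simp only [doubleCover, Equiv.symm_apply_apply]
        refine ⟨?_, f.map_adj hadj⟩
        rcases hF.2.2 hadj with ⟨hu, hv⟩ | ⟨hu, hv⟩
        · simp [hu, show v ∉ A from fun h => hdisj h hv]
        · simp [hv, show u ∉ A from fun h => hdisj h hu]⟩,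
      fun a ha => mem_doubleCoverSide_iff.2 (if_pos ha),
      fun b hb => mem_doubleCoverSide_iff.2 (if_neg fun h => Set.disjoint_left.1 hF.1 h hb)⟩
  left_inv h := by
    apply Subtype.ext
    ext1 v
    apply finProdFinEquiv.symm.injective
    refine (finProdFinEquiv.symm_apply_apply _).trans (Prod.ext ?_ rfl)
    by_cases hv : v ∈ A
    · exact (if_pos hv).trans (h.2.1 v hv).symm
    · have hB : v ∈ B := (hF.2.1.symm ▸ Set.mem_univ v : v ∈ A ∪ B).resolve_left hv
      exact (if_neg hv).trans (h.2.2 v hB).symm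
  right_inv f := by
    ext1 v
    exact congrArg Prod.snd (finProdFinEquiv.symm_apply_apply _)

lemma bipHomCount_doubleCover {V : Type*} {F : SimpleGraph V} {A B : Set V}
    (hF : IsBipartition F A B) {n : ℕ} (G : SimpleGraph (Fin n)) :
    bipHomCount F A B (doubleCover G) (doubleCoverSide n 0) (doubleCoverSide n 1) =
      homCount F G :=
  Nat.card_congr (homDoubleCoverEquiv hF G)

/-- If a bipartite graph `F` with bipartition `(A,B)` lies in the bipartite non-uniform
homomorphism distinguishing closure `cl^bip_{n,n}(𝓕)` (it cannot distinguish more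
`(n,n)`-vertex bipartite graphs, with fixed bipartitions, than `𝓕` can via
bipartition-respecting homomorphism counts), then `F ∈ cl_n(𝓕)`: it cannot distinguish
more `n`-vertex graphs than `𝓕` can via ordinary homomorphism counts. -/
theorem mem_clbip_imp_mem_cl (𝓕 : Set (Σ k : ℕ, SimpleGraph (Fin k)))
    (h𝓕 : ∀ p ∈ 𝓕, ∃ A B : Set (Fin p.1), IsBipartition p.2 A B)
    (n : ℕ) (kF : ℕ) (F : SimpleGraph (Fin kF)) (A B : Set (Fin kF))
    (hF : IsBipartition F A B)
    (hclbip : ∀ (kG : ℕ) (G : SimpleGraph (Fin kG)) (X Y : Set (Fin kG)),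
      IsBipartition G X Y → X.ncard = n → Y.ncard = n →
      ∀ (kH : ℕ) (H : SimpleGraph (Fin kH)) (X' Y' : Set (Fin kH)),
      IsBipartition H X' Y' → X'.ncard = n → Y'.ncard = n →
      (∀ p ∈ 𝓕, ∀ A' B' : Set (Fin p.1), IsBipartition p.2 A' B' →
        bipHomCount p.2 A' B' G X Y = bipHomCount p.2 A' B' H X' Y') →
      bipHomCount F A B G X Y = bipHomCount F A B H X' Y') :
    ∀ G H : SimpleGraph (Fin n),
      (∀ p ∈ 𝓕, homCount p.2 G = homCount p.2 H) → homCount F G = homCount F H := by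
  intro G H hGH
  rw [← bipHomCount_doubleCover hF G, ← bipHomCount_doubleCover hF H]
  refine hclbip _ _ _ _ (isBipartition_doubleCover G) (ncard_doubleCoverSide n 0)
    (ncard_doubleCoverSide n 1) _ _ _ _ (isBipartition_doubleCover H)
    (ncard_doubleCoverSide n 0) (ncard_doubleCoverSide n 1) fun p hp A' B' hp' => ?_
  rw [bipHomCount_doubleCover hp', bipHomCount_doubleCover hp', hGH p hp]
end

section
/- For all n, m ∈ ℕ there exist finitely many bipartite multigraphs F₁, …, F_r such that every Sym_n × Sym_m-symmetric polynomial p ∈ ℚ[X_{n,m}] lies in the ℚ-subalgebra of ℚ[X_{n,m}] generated by hom_{F₁,n,m}, …, hom_{F_r,n,m}; that is, there exists a polynomial q ∈ ℚ[y₁, …, y_r] with p = q(hom_{F₁,n,m}, …, hom_{F_r,n,m}). -/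
open MvPolynomial Finset

/-- A bipartite multigraph: side sizes together with an edge-multiplicity function. -/
structure BipartiteMultigraph where
  fst : ℕ
  snd : ℕ
  E : Fin fst × Fin snd → ℕ

section InjectiveSums

variable {α γ M : Type*} [Fintype α] [AddCommGroup M]

/-- Expansion of the indicator of injectivity by inclusion-exclusion over the sets of
pairs of points that are identified. -/
theorem ite_injective_eq_sum [DecidableEq α] [DecidableEq γ] (f : α → γ)
    [Decidable (Function.Injective f)] :
    (if Function.Injective f then 1 else 0 : ℤ) =
      ∑ S ∈ (univ : Finset α).offDiag.powerset,
        (-1) ^ #S * if ∀ p ∈ S, f p.1 = f p.2 then 1 else 0 := by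
  have h : (if Function.Injective f then 1 else 0 : ℤ) =
      ∏ p ∈ (univ : Finset α).offDiag, (1 + -(if f p.1 = f p.2 then 1 else 0 : ℤ)) := by
    split_ifs with hf
    · refine (prod_eq_one fun p hp => ?_).symm
      rw [if_neg (hf.ne (mem_offDiag.mp hp).2.2)]
      simp
    · simp only [Function.Injective, not_forall] at hf
      obtain ⟨a, b, hab, hne⟩ := hf
      refine (prod_eq_zero (i := (a, b)) (by simp [hne]) ?_).symm
      simp [hab]
  rw [h, prod_one_add]
  refine sum_congr rfl fun S _ => ?_
  rw [prod_neg, prod_ite_zero]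
  simp

open Classical in
/-- Maps out of a quotient are the maps that respect the relation. -/
theorem sum_quot_comp_mk [Fintype γ] (r : α → α → Prop) [Fintype (Quot r)]
    (Ψ : (α → γ) → M) :
    ∑ h : Quot r → γ, Ψ (h ∘ Quot.mk r) = ∑ f : α → γ with (∀ a b, r a b → f a = f b), Ψ f := by
  refine sum_bij (fun h _ => h ∘ Quot.mk r) ?_ ?_ ?_ fun _ _ => rfl
  · intro h _
    simp only [mem_filter, mem_univ, true_and, Function.comp_apply]
    exact fun a b hab => congrArg h (Quot.sound hab)
  · intro h₁ _ h₂ _ h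
    exact Quot.mk_surjective.injective_comp_right h
  · intro f hf
    exact ⟨Quot.lift f (mem_filter.mp hf).2, mem_univ _, rfl⟩

open Classical in
/-- A subgroup containing the sums of `Ψ` over all maps out of quotients of `α` contains
the sum of `Ψ` over the permutations of `α`. -/
theorem sum_perm_mem_of_forall_sum_quot_mem [DecidableEq α] {σ : Type*} [SetLike σ M]
    [AddSubgroupClass σ M] (V : σ) (Ψ : (α → α) → M)
    (hV : ∀ (r : α → α → Prop) [Fintype (Quot r)], ∑ h : Quot r → α, Ψ (h ∘ Quot.mk r) ∈ V) :
    ∑ π : Equiv.Perm α, Ψ π ∈ V := by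
  have h₁ : ∑ π : Equiv.Perm α, Ψ π = ∑ f : α → α with Function.Injective f, Ψ f := by
    refine sum_bij (fun π _ => ⇑π) (fun π _ => by simp [π.injective])
      (fun π₁ _ π₂ _ h => DFunLike.coe_injective h) (fun f hf => ?_) fun _ _ => rfl
    exact ⟨Equiv.ofBijective f (Finite.injective_iff_bijective.mp (mem_filter.mp hf).2),
      mem_univ _, rfl⟩
  have h₂ : ∑ f : α → α with Function.Injective f, Ψ f =
      ∑ S ∈ (univ : Finset α).offDiag.powerset, (-1 : ℤ) ^ #S •
        ∑ f : α → α with ∀ a b, (a, b) ∈ S → f a = f b, Ψ f := by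
    have h (f : α → α) : (if Function.Injective f then Ψ f else 0) =
        (if Function.Injective f then 1 else 0 : ℤ) • Ψ f := by split_ifs <;> simp
    simp_rw [sum_filter, h, ite_injective_eq_sum, sum_smul, smul_sum]
    rw [sum_comm]
    refine sum_congr rfl fun S _ => sum_congr rfl fun f _ => ?_
    simp only [Prod.forall, mul_smul]
    split_ifs <;> simp
  rw [h₁, h₂]
  refine sum_mem fun S _ => zsmul_mem ?_ _
  have := Fintype.ofFinite (Quot fun a b => (a, b) ∈ S)
  convert hV fun a b => (a, b) ∈ S using 1
  rw [sum_quot_comp_mk]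
  congr!

end InjectiveSums

/-- The span of all homomorphism polynomials. -/
noncomputable def homSpan (n m : ℕ) : Submodule ℚ (MvPolynomial (Fin n × Fin m) ℚ) :=
  Submodule.span ℚ (Set.range fun F : BipartiteMultigraph => homPoly n m F.fst F.snd F.E)

theorem homPoly_mem_homSpan {n m α β : ℕ} (E : Fin α × Fin β → ℕ) :
    homPoly n m α β E ∈ homSpan n m :=
  Submodule.subset_span ⟨⟨α, β, E⟩, rfl⟩

/-- The homomorphism polynomial of a bipartite multigraph on arbitrary finite vertex types
lies in the span of the homomorphism polynomials. -/
theorem sum_sum_prod_mem_homSpan {n m : ℕ} {A B : Type*} [Fintype A] [Fintype B]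
    [DecidableEq A] [DecidableEq B] (E : A × B → ℕ) :
    ∑ f : A → Fin n, ∑ g : B → Fin m,
      ∏ p : A × B, (X (f p.1, g p.2) : MvPolynomial (Fin n × Fin m) ℚ) ^ E p ∈ homSpan n m := by
  let a := Fintype.equivFin A
  let b := Fintype.equivFin B
  convert homPoly_mem_homSpan (n := n) (m := m) fun p => E (a.symm p.1, b.symm p.2) using 1
  rw [homPoly]
  refine Fintype.sum_equiv (a.arrowCongr (Equiv.refl _)) _ _ fun f =>
    Fintype.sum_equiv (b.arrowCongr (Equiv.refl _)) _ _ fun g =>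
    Fintype.prod_equiv (a.prodCongr b) _ _ fun p => ?_
  simp

/-- Contracting vertices of a bipartite multigraph adds up edge multiplicities. -/
theorem prod_pow_eq_prod_pow_sum_fiber {P Q R : Type*} [Fintype P] [Fintype Q] [DecidableEq Q]
    [CommMonoid R] (φ : P → Q) (y : Q → R) (E : P → ℕ) :
    ∏ p, y (φ p) ^ E p = ∏ q, y q ^ ∑ p with φ p = q, E p := by
  rw [← prod_fiberwise univ φ]
  refine prod_congr rfl fun q _ => ?_
  rw [← prod_pow_eq_pow_sum]
  refine prod_congr rfl fun p hp => ?_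
  rw [(mem_filter.mp hp).2]

open Classical in
theorem sum_perm_sum_perm_prod_mem_homSpan {n m : ℕ} (E : Fin n × Fin m → ℕ) :
    ∑ π : Equiv.Perm (Fin n), ∑ σ : Equiv.Perm (Fin m),
      ∏ p : Fin n × Fin m,
        (X (π p.1, σ p.2) : MvPolynomial (Fin n × Fin m) ℚ) ^ E p ∈ homSpan n m := by
  refine sum_perm_mem_of_forall_sum_quot_mem (homSpan n m)
    (fun f => ∑ σ : Equiv.Perm (Fin m), ∏ p : Fin n × Fin m, X (f p.1, σ p.2) ^ E p) fun r _ => ?_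
  rw [sum_comm]
  refine sum_perm_mem_of_forall_sum_quot_mem (homSpan n m)
    (fun g => ∑ h : Quot r → Fin n, ∏ p : Fin n × Fin m,
      X ((h ∘ Quot.mk r) p.1, g p.2) ^ E p) fun s _ => ?_
  rw [sum_comm]
  convert sum_sum_prod_mem_homSpan (n := n) (m := m) (A := Quot r) (B := Quot s)
    (fun q => ∑ p with Prod.map (Quot.mk r) (Quot.mk s) p = q, E p) using 4 with h _ k _
  exact prod_pow_eq_prod_pow_sum_fiber (Prod.map (Quot.mk r) (Quot.mk s))
    (fun q => X (h q.1, k q.2)) E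

/-- Every `Sym_n × Sym_m`-symmetric polynomial is a linear combination of homomorphism
polynomials. -/
theorem mem_homSpan_of_symmetric {n m : ℕ} {p : MvPolynomial (Fin n × Fin m) ℚ}
    (hp : ∀ (π : Equiv.Perm (Fin n)) (σ : Equiv.Perm (Fin m)),
      rename (fun q : Fin n × Fin m => (π q.1, σ q.2)) p = p) :
    p ∈ homSpan n m := by
  have average_mem (q : MvPolynomial (Fin n × Fin m) ℚ) :
      ∑ π : Equiv.Perm (Fin n), ∑ σ : Equiv.Perm (Fin m),
        rename (fun q : Fin n × Fin m => (π q.1, σ q.2)) q ∈ homSpan n m := by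
    induction q using MvPolynomial.induction_on' with
    | monomial E c =>
      convert (homSpan n m).smul_mem c (sum_perm_sum_perm_prod_mem_homSpan E) using 1
      simp_rw [smul_sum]
      refine sum_congr rfl fun π _ => sum_congr rfl fun σ _ => ?_
      rw [monomial_eq, Finsupp.prod_fintype _ _ fun _ => pow_zero _]
      simp [smul_eq_C_mul]
    | add q₁ q₂ h₁ h₂ =>
      simp only [map_add, sum_add_distrib]
      exact add_mem h₁ h₂
  have h := average_mem p
  simp only [hp, sum_const, card_univ, ← Nat.cast_smul_eq_nsmul ℚ, smul_smul] at h
  refine ((homSpan n m).smul_mem_iff ?_).mp h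
  exact mul_ne_zero (Nat.cast_ne_zero.mpr Fintype.card_ne_zero)
    (Nat.cast_ne_zero.mpr Fintype.card_ne_zero)

/-- **Noether's theorem**: the invariants of a finite group acting on a finitely generated
algebra over a Noetherian ring are finitely generated. -/
theorem FixedPoints.subalgebra_fg (R B G : Type*) [CommRing R] [IsNoetherianRing R] [CommRing B]
    [Algebra R B] [Algebra.FiniteType R B] [Group G] [Finite G] [MulSemiringAction G B]
    [SMulCommClass G R B] : (FixedPoints.subalgebra R B G).FG := by
  have : Algebra.IsInvariant (FixedPoints.subalgebra R B G) B G :=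
    ⟨fun b hb => ⟨⟨b, hb⟩, rfl⟩⟩
  have : Algebra.IsIntegral (FixedPoints.subalgebra R B G) B := Algebra.IsInvariant.isIntegral _ _ G
  have : Algebra.FiniteType (FixedPoints.subalgebra R B G) B :=
    Algebra.FiniteType.of_restrictScalars_finiteType R _ B
  have : Module.Finite (FixedPoints.subalgebra R B G) B := Algebra.IsIntegral.finite
  exact (Subalgebra.fg_top _).mp
    (fg_of_fg_of_fg R _ B Algebra.FiniteType.out Module.Finite.fg_top Subtype.val_injective)

/-- The action of `Sym_n × Sym_m` on polynomials by renaming variables. -/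
noncomputable def renameProdHom (n m : ℕ) :
    Equiv.Perm (Fin n) × Equiv.Perm (Fin m) →*
      (MvPolynomial (Fin n × Fin m) ℚ ≃ₐ[ℚ] MvPolynomial (Fin n × Fin m) ℚ) where
  toFun g := renameEquiv ℚ (g.1.prodCongr g.2)
  map_one' := by
    ext1 p
    exact rename_id_apply p
  map_mul' g h := by
    ext1 p
    exact (rename_rename (h.1.prodCongr h.2) (g.1.prodCongr g.2) p).symm

theorem exists_finset_symmetric_mem_adjoin (n m : ℕ) :
    ∃ S : Finset (MvPolynomial (Fin n × Fin m) ℚ), ∀ p : MvPolynomial (Fin n × Fin m) ℚ,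
      (∀ (π : Equiv.Perm (Fin n)) (σ : Equiv.Perm (Fin m)),
          rename (fun q : Fin n × Fin m => (π q.1, σ q.2)) p = p) ↔
        p ∈ Algebra.adjoin ℚ (S : Set (MvPolynomial (Fin n × Fin m) ℚ)) := by
  have : Finite (renameProdHom n m).range := Set.finite_range (renameProdHom n m)
  obtain ⟨S, hS⟩ := FixedPoints.subalgebra_fg ℚ (MvPolynomial (Fin n × Fin m) ℚ)
    (renameProdHom n m).range
  refine ⟨S, fun p => ?_⟩
  rw [hS]
  constructor
  · rintro hp ⟨_, ⟨π, σ⟩, rfl⟩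
    exact hp π σ
  · exact fun hp π σ => hp ⟨_, (π, σ), rfl⟩

/-- For all `n, m` there are finitely many bipartite multigraphs `F₁, …, F_r` such that
every `Sym_n × Sym_m`-symmetric polynomial lies in the ℚ-subalgebra of `ℚ[X_{n,m}]`
generated by `hom_{F₁,n,m}, …, hom_{F_r,n,m}`. -/
theorem exists_finite_generating_homPolys (n m : ℕ) :
    ∃ (r : ℕ) (F : Fin r → BipartiteMultigraph),
      ∀ p : MvPolynomial (Fin n × Fin m) ℚ,
        (∀ (π : Equiv.Perm (Fin n)) (σ : Equiv.Perm (Fin m)),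
          rename (fun q : Fin n × Fin m => (π q.1, σ q.2)) p = p) →
        p ∈ Algebra.adjoin ℚ
          (Set.range fun i : Fin r => homPoly n m (F i).fst (F i).snd (F i).E) := by
  classical
  obtain ⟨S, hS⟩ := exists_finset_symmetric_mem_adjoin n m
  have hspan : (S : Set (MvPolynomial (Fin n × Fin m) ℚ)) ⊆ homSpan n m := fun s hs =>
    mem_homSpan_of_symmetric ((hS s).mpr (Algebra.subset_adjoin hs))
  obtain ⟨T, hT, hST⟩ := Submodule.subset_span_finite_of_subset_span hspan
  choose F hF using fun i => hT (T.equivFin.symm i).2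
  refine ⟨#T, F, fun p hp => ?_⟩
  have hrange : (Set.range fun i => homPoly n m (F i).fst (F i).snd (F i).E) = T := by
    simp only [hF]
    ext t
    exact ⟨by rintro ⟨i, rfl⟩; exact (T.equivFin.symm i).2,
      fun ht => ⟨T.equivFin ⟨t, ht⟩, by simp⟩⟩
  rw [hrange]
  exact Algebra.adjoin_le (fun s hs => Algebra.span_le_adjoin ℚ _ (hST hs)) ((hS p).mp hp)
end

section
/- Let ℓ, r, n, m ∈ ℕ and let F and F' be (ℓ, r)-labelled bipartite multigraphs with data (α, β, E, a, b) and (α', β', E', a', b'). Define the glued (ℓ, r)-labelled bipartite multigraph F ⊙ F' as follows: its left side is the quotient of Fin α ⊕ Fin α' by the equivalence relation generated by identifying a(i) with a'(i) for every i ∈ Fin ℓ; its right side is the quotient of Fin β ⊕ Fin β' by identifying b(j) with b'(j) for every j ∈ Fin r; the multiplicity of an edge between a left class and a right class is the total multiplicity, summed over E and E', of edge slots of F and of F' whose endpoints project to these classes; and its labels are the classes of the a(i) and the b(j). Then for all tuples v : Fin ℓ → Fin n and w : Fin r → Fin m, the labelled homomorphism polynomials satisfy (F ⊙ F')_{n,m}(v,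 w) = F_{n,m}(v, w) · F'_{n,m}(v, w) in ℚ[X_{n,m}]. -/
open MvPolynomial Finset

/-- An `(ℓ, r)`-labelled bipartite multigraph: finite left and right vertex types, an
edge-multiplicity function, and label tuples into the two sides. -/
structure LabelledBMG (ℓ r : ℕ) where
  L : Type
  R : Type
  finL : Finite L
  finR : Finite R
  E : L × R → ℕ
  a : Fin ℓ → L
  b : Fin r → R

/-- The labelled homomorphism polynomial `F_{n,m}(v, w)`: the sum over pairs of maps
`f, g` on the two sides sending the labels to `v`, `w` of the monomials recording where
the edges go (with multiplicities). -/
noncomputable def lhomPoly {ℓ r : ℕ} (F : LabelledBMG ℓ r) (n m : ℕ)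
    (v : Fin ℓ → Fin n) (w : Fin r → Fin m) : MvPolynomial (Fin n × Fin m) ℚ :=
  haveI := F.finL
  haveI := F.finR
  letI : Fintype F.L := Fintype.ofFinite _
  letI : Fintype F.R := Fintype.ofFinite _
  letI : ∀ p : Prop, Decidable p := fun p => Classical.propDecidable p
  ∑ f : F.L → Fin n, ∑ g : F.R → Fin m,
    if f ∘ F.a = v ∧ g ∘ F.b = w then
      ∏ p : F.L × F.R, (X (f p.1, g p.2) : MvPolynomial (Fin n × Fin m) ℚ) ^ F.E p
    else 0

/-- The identification relation on left vertices of the disjoint union: `a i ~ a' i`. -/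
def glueRelL {ℓ r : ℕ} (F F' : LabelledBMG ℓ r) : F.L ⊕ F'.L → F.L ⊕ F'.L → Prop :=
  fun x y => ∃ i : Fin ℓ, x = Sum.inl (F.a i) ∧ y = Sum.inr (F'.a i)

/-- The identification relation on right vertices of the disjoint union: `b j ~ b' j`. -/
def glueRelR {ℓ r : ℕ} (F F' : LabelledBMG ℓ r) : F.R ⊕ F'.R → F.R ⊕ F'.R → Prop :=
  fun x y => ∃ j : Fin r, x = Sum.inl (F.b j) ∧ y = Sum.inr (F'.b j)

/-- The glued `(ℓ, r)`-labelled bipartite multigraph `F ⊙ F'`: each side is the quotient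
of the disjoint union of the sides by the equivalence relation generated by identifying
corresponding labels; the multiplicity of an edge between two classes is the total
multiplicity of the edge slots of `F` and of `F'` projecting to these classes; the
labels are the classes of the labels of `F` (equivalently, of `F'`). -/
noncomputable def glue {ℓ r : ℕ} (F F' : LabelledBMG ℓ r) : LabelledBMG ℓ r where
  L := Quot (glueRelL F F')
  R := Quot (glueRelR F F')
  finL := by
    have := F.finL; have := F'.finL
    exact Quot.finite _
  finR := by
    have := F.finR; have := F'.finR
    exact Quot.finite _
  E := fun p =>
    haveI := F.finL; haveI := F.finR; haveI := F'.finL; haveI := F'.finR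
    letI : Fintype F.L := Fintype.ofFinite _
    letI : Fintype F.R := Fintype.ofFinite _
    letI : Fintype F'.L := Fintype.ofFinite _
    letI : Fintype F'.R := Fintype.ofFinite _
    letI : ∀ q : Prop, Decidable q := fun q => Classical.propDecidable q
    (∑ q : F.L × F.R,
      if Quot.mk _ (Sum.inl q.1) = p.1 ∧ Quot.mk _ (Sum.inl q.2) = p.2 then F.E q else 0) +
    ∑ q : F'.L × F'.R,
      if Quot.mk _ (Sum.inr q.1) = p.1 ∧ Quot.mk _ (Sum.inr q.2) = p.2 then F'.E q else 0
  a := fun i => Quot.mk _ (Sum.inl (F.a i))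
  b := fun j => Quot.mk _ (Sum.inl (F.b j))

/-- Maps out of the gluing of two types along label tuples `a`, `a'` that send the labels
to `v` correspond to pairs of such maps out of the two types. -/
def glueMapEquiv {ι A A' Y : Type*} (a : ι → A) (a' : ι → A') (v : ι → Y) :
    {f : Quot (fun x y : A ⊕ A' => ∃ i, x = Sum.inl (a i) ∧ y = Sum.inr (a' i)) → Y //
      (f ∘ fun i => Quot.mk _ (Sum.inl (a i))) = v} ≃
      {f : A → Y // f ∘ a = v} × {f : A' → Y // f ∘ a' = v} where
  toFun f := ⟨⟨fun x => f.1 (Quot.mk _ (Sum.inl x)), f.2⟩,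
    ⟨fun x => f.1 (Quot.mk _ (Sum.inr x)), funext fun i =>
      (congrArg f.1 (Quot.sound ⟨i, rfl, rfl⟩).symm).trans (congrFun f.2 i)⟩⟩
  invFun p := ⟨Quot.lift (Sum.elim p.1.1 p.2.1) (by
      rintro _ _ ⟨i, rfl, rfl⟩
      exact (congrFun p.1.2 i).trans (congrFun p.2.2 i).symm), p.1.2⟩
  left_inv f := by
    apply Subtype.ext
    funext x
    induction x using Quot.ind with
    | mk x => cases x <;> rfl
  right_inv _ := rfl

/-- Summing exponents over the fibres of a map does not change a product of powers. -/
theorem Finset.prod_pow_sum_fiber {M P Q : Type*} [CommMonoid M] [Fintype P] [Fintype Q]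
    (c : Q → P → Prop) [∀ q p, Decidable (c q p)] (π : Q → P) (hc : ∀ q p, c q p ↔ π q = p)
    (h : P → M) (e : Q → ℕ) :
    ∏ p, h p ^ (∑ q, if c q p then e q else 0) = ∏ q, h (π q) ^ e q := by
  classical
  simp only [← Finset.prod_pow_eq_pow_sum, hc]
  rw [Finset.prod_comm]
  refine Finset.prod_congr rfl fun q _ => ?_
  rw [Finset.prod_eq_single (π q)]
  · simp
  · intro p _ hp
    simp [hp.symm]
  · simp

/-- The labelled homomorphism polynomial as a sum over pairs of label-respecting maps. -/
theorem lhomPoly_eq_sum_subtype {ℓ r : ℕ} (F : LabelledBMG ℓ r) (n m : ℕ)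
    (v : Fin ℓ → Fin n) (w : Fin r → Fin m) [Fintype F.L] [Fintype F.R]
    [Fintype {f : F.L → Fin n // f ∘ F.a = v}] [Fintype {g : F.R → Fin m // g ∘ F.b = w}] :
    lhomPoly F n m v w =
      ∑ f : {f : F.L → Fin n // f ∘ F.a = v}, ∑ g : {g : F.R → Fin m // g ∘ F.b = w},
        ∏ p : F.L × F.R, (X (f.1 p.1, g.1 p.2) : MvPolynomial (Fin n × Fin m) ℚ) ^ F.E p := by
  classical
  have key (T : (F.L → Fin n) → (F.R → Fin m) → MvPolynomial (Fin n × Fin m) ℚ) :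
      (∑ f, ∑ g, if f ∘ F.a = v ∧ g ∘ F.b = w then T f g else 0) =
        ∑ f : {f : F.L → Fin n // f ∘ F.a = v}, ∑ g : {g : F.R → Fin m // g ∘ F.b = w},
          T f.1 g.1 := by
    simp only [ite_and, Finset.sum_ite_irrel, Finset.sum_const_zero, ← Finset.sum_filter]
    rw [Finset.sum_subtype (p := fun f : F.L → Fin n => f ∘ F.a = v) _ (by simp)]
    refine Finset.sum_congr rfl fun f _ => ?_
    rw [Finset.sum_subtype (p := fun g : F.R → Fin m => g ∘ F.b = w) _ (by simp)]
  rw [← key fun f g => ∏ p : F.L × F.R, X (f p.1, g p.2) ^ F.E p]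
  unfold lhomPoly
  convert rfl

/-- The edge monomial of a map out of a glued multigraph is the product of the edge monomials
of its restrictions. -/
theorem glue_prod_pow {ℓ r : ℕ} {M : Type*} [CommMonoid M] (F F' : LabelledBMG ℓ r)
    [Fintype F.L] [Fintype F.R] [Fintype F'.L] [Fintype F'.R]
    [Fintype (glue F F').L] [Fintype (glue F F').R]
    (h : (glue F F').L × (glue F F').R → M) :
    ∏ p, h p ^ (glue F F').E p =
      (∏ q : F.L × F.R, h (Quot.mk _ (Sum.inl q.1), Quot.mk _ (Sum.inl q.2)) ^ F.E q) *
        ∏ q : F'.L × F'.R, h (Quot.mk _ (Sum.inr q.1), Quot.mk _ (Sum.inr q.2)) ^ F'.E q := by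
  classical
  rw [← Finset.prod_pow_sum_fiber
      (fun (q : F.L × F.R) (p : (glue F F').L × (glue F F').R) =>
        Quot.mk _ (Sum.inl q.1) = p.1 ∧ Quot.mk _ (Sum.inl q.2) = p.2)
      (fun q => (Quot.mk _ (Sum.inl q.1), Quot.mk _ (Sum.inl q.2)))
      (fun _ _ => ⟨fun e => Prod.ext e.1 e.2,
        fun e => ⟨congrArg Prod.fst e, congrArg Prod.snd e⟩⟩) h F.E,
    ← Finset.prod_pow_sum_fiber
      (fun (q : F'.L × F'.R) (p : (glue F F').L × (glue F F').R) =>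
        Quot.mk _ (Sum.inr q.1) = p.1 ∧ Quot.mk _ (Sum.inr q.2) = p.2)
      (fun q => (Quot.mk _ (Sum.inr q.1), Quot.mk _ (Sum.inr q.2)))
      (fun _ _ => ⟨fun e => Prod.ext e.1 e.2,
        fun e => ⟨congrArg Prod.fst e, congrArg Prod.snd e⟩⟩) h F'.E,
    ← Finset.prod_mul_distrib]
  refine Finset.prod_congr rfl fun p _ => ?_
  rw [← pow_add]
  congr 1
  unfold glue
  dsimp only
  congr!

/-- Gluing of labelled bipartite multigraphs corresponds to multiplication of their
labelled homomorphism polynomials: `(F ⊙ F')_{n,m}(v, w) = F_{n,m}(v, w) · F'_{n,m}(v, w)`. -/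
theorem lhomPoly_glue {ℓ r : ℕ} (F F' : LabelledBMG ℓ r) (n m : ℕ)
    (v : Fin ℓ → Fin n) (w : Fin r → Fin m) :
    lhomPoly (glue F F') n m v w = lhomPoly F n m v w * lhomPoly F' n m v w := by
  classical
  have := F.finL
  have := F.finR
  have := F'.finL
  have := F'.finR
  have := (glue F F').finL
  have := (glue F F').finR
  let _ := Fintype.ofFinite F.L
  let _ := Fintype.ofFinite F.R
  let _ := Fintype.ofFinite F'.L
  let _ := Fintype.ofFinite F'.R
  let _ := Fintype.ofFinite (glue F F').L
  let _ := Fintype.ofFinite (glue F F').R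
  let eL : {f : (glue F F').L → Fin n // f ∘ (glue F F').a = v} ≃ _ :=
    glueMapEquiv F.a F'.a v
  let eR : {g : (glue F F').R → Fin m // g ∘ (glue F F').b = w} ≃ _ :=
    glueMapEquiv F.b F'.b w
  simp only [lhomPoly_eq_sum_subtype, glue_prod_pow]
  rw [Finset.sum_mul_sum]
  refine (Fintype.sum_equiv eL _ _ fun f => ?_).trans (Fintype.sum_prod_type' _)
  rw [Finset.sum_mul_sum]
  refine (Fintype.sum_equiv eR _ _ fun g => ?_).trans (Fintype.sum_prod_type' _)
  rfl
end

section
/- Let R be a finite type, λ : R → ℕ, and n ∈ ℕ, and work in the polynomial ring MvPolynomial (Fin n) ℚ with variables y_v for v ∈ Fin n. Then ∑_{injective f : R ↪ Fin n} ∏_{r ∈ R} y_{f(r)}^{λ(r)} = ∑_{π a partition of R} μ_π · ∏_{s ∈ R/π} ( ∑_{v ∈ Fin n} y_v^{∑_{r ∈ s} λ(r)} ). (For λ the part sizes of a partition of an integer, the left-hand side is, up to the normalising factor α_λ, the monomial symmetric polynomial m_λ(y₁, …, y_n); this identity expresses it in terms of power sums.) -/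
open MvPolynomial Finset

/-- The Möbius coefficient `μ_π = (-1)^{|R| - #parts} ∏_{P ∈ parts} (|P|-1)!` of a
partition `π` of a finite type `R`. -/
def moebius {R : Type*} [Fintype R] [DecidableEq R]
    (π : Finpartition (univ : Finset R)) : ℤ :=
  (-1) ^ (Fintype.card R - π.parts.card) * ∏ P ∈ π.parts, ((P.card - 1).factorial : ℤ)

namespace Finpartition

variable {R : Type*} [DecidableEq R] {S : Finset R} {a : R}

/-- Adjoin a new element `a` to the block `B` of a partition `π`, or as a singleton block
if `B = ∅`. -/
def adjoin (π : Finpartition S) (ha : a ∉ S) (B : Finset R) (hB : B ∈ insert ∅ π.parts) :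
    Finpartition (insert a S) :=
  ofExistsUnique (insert (insert a B) (π.parts.erase B))
    (by
      have hBS : B ⊆ S := by
        rcases mem_insert.1 hB with rfl | h
        · exact empty_subset S
        · exact π.subset h
      intro p hp
      rcases mem_insert.1 hp with rfl | hp
      · exact insert_subset_insert a hBS
      · exact (π.subset (mem_of_mem_erase hp)).trans (subset_insert a S))
    (by
      intro x hx
      rcases mem_insert.1 hx with rfl | hxS
      · refine ⟨insert x B, by simp, ?_⟩
        rintro t ⟨ht, hxt⟩
        rcases mem_insert.1 ht with rfl | ht
        · rfl
        · exact absurd (π.subset (mem_of_mem_erase ht) hxt) ha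
      · have hxa : x ≠ a := by rintro rfl; exact ha hxS
        by_cases hxB : x ∈ B
        · have hBp : B ∈ π.parts := (mem_insert.1 hB).resolve_left (by rintro rfl; simp at hxB)
          refine ⟨insert a B, by simp [hxB], ?_⟩
          rintro t ⟨ht, hxt⟩
          rcases mem_insert.1 ht with rfl | ht
          · rfl
          · exact absurd (π.eq_of_mem_parts (mem_of_mem_erase ht) hBp hxt hxB)
              (ne_of_mem_erase ht)
        · obtain ⟨T, hT, hxT⟩ := π.exists_mem hxS
          have hTB : T ≠ B := by rintro rfl; exact hxB hxT
          refine ⟨T, ⟨mem_insert_of_mem (mem_erase.2 ⟨hTB, hT⟩), hxT⟩, ?_⟩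
          rintro t ⟨ht, hxt⟩
          rcases mem_insert.1 ht with rfl | ht
          · exact absurd ((mem_insert.1 hxt).resolve_left hxa) hxB
          · exact π.eq_of_mem_parts (mem_of_mem_erase ht) hT hxt hxT)
    (by
      rw [mem_insert, not_or]
      exact ⟨(insert_ne_empty a B).symm, fun h => π.empty_notMem_parts (mem_of_mem_erase h)⟩)

@[simp]
theorem adjoin_parts (π : Finpartition S) (ha : a ∉ S) (B : Finset R)
    (hB : B ∈ insert ∅ π.parts) :
    (π.adjoin ha B hB).parts = insert (insert a B) (π.parts.erase B) := rfl

theorem notMem_of_mem_parts (π : Finpartition S) (ha : a ∉ S) {P : Finset R}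
    (hP : P ∈ π.parts) : a ∉ P :=
  fun h => ha (π.subset hP h)

theorem inter_eq_of_mem_parts {ρ : Finpartition (insert a S)} {P : Finset R}
    (ha : a ∉ S) (hP : P ∈ ρ.parts) : P ∩ S = P.erase a := by
  have := ρ.subset hP
  grind

theorem mem_parts_restrict_insert (ρ : Finpartition (insert a S)) (ha : a ∉ S) {P : Finset R} :
    P ∈ (ρ.restrict (subset_insert a S)).parts ↔
      P ≠ ∅ ∧ ∃ Q ∈ ρ.parts, Q.erase a = P := by
  simp only [restrict, mem_erase, mem_image, bot_eq_empty, inf_eq_inter]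
  refine and_congr_right fun _ => exists_congr fun Q => and_congr_right fun hQ => ?_
  rw [inter_eq_of_mem_parts ha hQ]

theorem part_erase_mem_insert_parts_restrict (ρ : Finpartition (insert a S)) (ha : a ∉ S) :
    (ρ.part a).erase a ∈ insert ∅ (ρ.restrict (subset_insert a S)).parts := by
  rw [mem_insert, mem_parts_restrict_insert ρ ha]
  have := ρ.part_mem.2 (mem_insert_self a S)
  tauto

theorem part_adjoin (π : Finpartition S) (ha : a ∉ S) (B : Finset R)
    (hB : B ∈ insert ∅ π.parts) : (π.adjoin ha B hB).part a = insert a B :=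
  part_eq_of_mem _ (mem_insert_self _ _) (mem_insert_self a B)

theorem restrict_adjoin (π : Finpartition S) (ha : a ∉ S) (B : Finset R)
    (hB : B ∈ insert ∅ π.parts) :
    (π.adjoin ha B hB).restrict (subset_insert a S) = π := by
  have h0 : ∅ ∉ π.parts := π.empty_notMem_parts
  have h1 : ∀ P ∈ π.parts, a ∉ P := fun P hP => π.notMem_of_mem_parts ha hP
  ext P
  rw [mem_parts_restrict_insert _ ha, adjoin_parts]
  constructor
  · rintro ⟨hP, Q, hQ, rfl⟩
    rcases mem_insert.1 hQ with rfl | hQ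
    · have haB : a ∉ B := by grind
      rw [erase_insert haB] at hP ⊢
      exact (mem_insert.1 hB).resolve_left hP
    · have hQp := mem_of_mem_erase hQ
      rwa [erase_eq_of_notMem (h1 Q hQp)]
  · intro hP
    refine ⟨by rintro rfl; exact h0 hP, ?_⟩
    by_cases hPB : P = B
    · exact ⟨insert a B, mem_insert_self _ _, by grind⟩
    · exact ⟨P, by grind, by grind⟩

theorem adjoin_restrict (ρ : Finpartition (insert a S)) (ha : a ∉ S) :
    (ρ.restrict (subset_insert a S)).adjoin ha ((ρ.part a).erase a)
      (ρ.part_erase_mem_insert_parts_restrict ha) = ρ := by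
  have hT := ρ.part_mem.2 (mem_insert_self a S)
  have haT : a ∈ ρ.part a := ρ.mem_part_self.2 (mem_insert_self a S)
  have hout : ∀ Q ∈ ρ.parts, Q ≠ ρ.part a → a ∉ Q := fun Q hQ hne haQ =>
    hne (ρ.eq_of_mem_parts hQ hT haQ haT)
  ext P
  rw [adjoin_parts, insert_erase haT, mem_insert, mem_erase, mem_parts_restrict_insert ρ ha]
  constructor
  · rintro (rfl | ⟨hne, -, Q, hQ, rfl⟩)
    · exact hT
    · have hQT : Q ≠ ρ.part a := by rintro rfl; exact hne rfl
      rwa [erase_eq_of_notMem (hout Q hQ hQT)]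
  · intro hP
    by_cases hPT : P = ρ.part a
    · exact Or.inl hPT
    · have haP := hout P hP hPT
      refine Or.inr ⟨?_, ρ.ne_empty hP, P, hP, erase_eq_of_notMem haP⟩
      rintro hPe
      obtain ⟨x, hx⟩ := ρ.nonempty_of_mem_parts hP
      exact hPT (ρ.eq_of_mem_parts hP hT hx (mem_of_mem_erase (hPe ▸ hx)))

theorem sum_insert {A : Type*} [AddCommMonoid A] (ha : a ∉ S) (F : Finset (Finset R) → A) :
    ∑ ρ : Finpartition (insert a S), F ρ.parts =
      ∑ π : Finpartition S, ∑ B ∈ insert ∅ π.parts,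
        F (insert (insert a B) (π.parts.erase B)) := by
  rw [sum_sigma']
  symm
  refine sum_bij' (fun x hx => x.1.adjoin ha x.2 (mem_sigma.1 hx).2)
    (fun ρ _ => ⟨ρ.restrict (subset_insert a S), (ρ.part a).erase a⟩)
    (fun _ _ => mem_univ _)
    (fun ρ _ => mem_sigma.2 ⟨mem_univ _, ρ.part_erase_mem_insert_parts_restrict ha⟩)
    ?_ (fun ρ _ => ρ.adjoin_restrict ha) (fun _ _ => rfl)
  rintro ⟨π, B⟩ hx
  have hB : B ∈ insert ∅ π.parts := (mem_sigma.1 hx).2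
  have haB : a ∉ B := by
    rcases mem_insert.1 hB with rfl | h
    · exact notMem_empty a
    · exact π.notMem_of_mem_parts ha h
  simp only [restrict_adjoin, part_adjoin, erase_insert haB]

theorem sum_prod_insert {A : Type*} [CommSemiring A] (ha : a ∉ S) (g : Finset R → A) :
    ∑ ρ : Finpartition (insert a S), ∏ P ∈ ρ.parts, g P =
      ∑ π : Finpartition S, (g {a} * ∏ P ∈ π.parts, g P +
        ∑ B ∈ π.parts, g (insert a B) * ∏ P ∈ π.parts.erase B, g P) := by
  rw [sum_insert ha fun s => ∏ P ∈ s, g P]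
  refine sum_congr rfl fun π _ => ?_
  have hnot (B : Finset R) : insert a B ∉ π.parts.erase B := fun h =>
    π.notMem_of_mem_parts ha (mem_of_mem_erase h) (mem_insert_self a B)
  simp only [prod_insert (hnot _)]
  rw [Finset.sum_insert π.empty_notMem_parts, erase_eq_of_notMem π.empty_notMem_parts,
    insert_empty_eq]

end Finpartition

section BlockWeight

variable {R V A : Type*} [CommRing A]

/-- The contribution of a block `P` to the Möbius sum: `(-1)^{|P|-1} (|P|-1)!` times the sum
over `v` of the products of the weights `w r v`, `r ∈ P`. -/
def blockWeight [Fintype V] (w : R → V → A) (P : Finset R) : A :=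
  (-1) ^ (#P - 1) * ((#P - 1).factorial : A) * ∑ v, ∏ r ∈ P, w r v

theorem blockWeight_singleton [Fintype V] (w : R → V → A) (a : R) :
    blockWeight w {a} = ∑ v, w a v := by
  simp [blockWeight]

/-- Multiply the weight at `b` by the weight at `a`. -/
def mergeWeight [DecidableEq R] (w : R → V → A) (a b : R) : R → V → A :=
  Function.update w b (w b * w a)

theorem prod_mergeWeight_of_notMem [DecidableEq R] (w : R → V → A) (a : R) {b : R}
    {P : Finset R} (hb : b ∉ P) (f : R → V) :
    ∏ r ∈ P, mergeWeight w a b r (f r) = ∏ r ∈ P, w r (f r) :=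
  prod_congr rfl fun r hr => by
    rw [mergeWeight, Function.update_of_ne (ne_of_mem_of_not_mem hr hb)]

theorem prod_mergeWeight_of_mem [DecidableEq R] (w : R → V → A) (a : R) {b : R}
    {P : Finset R} (hb : b ∈ P) (f : R → V) :
    ∏ r ∈ P, mergeWeight w a b r (f r) = w a (f b) * ∏ r ∈ P, w r (f r) := by
  rw [← mul_prod_erase P _ hb, ← mul_prod_erase P (fun r => w r (f r)) hb,
    prod_mergeWeight_of_notMem w a (notMem_erase b P)]
  simp only [mergeWeight, Function.update_self, Pi.mul_apply]
  ring

theorem blockWeight_mergeWeight_of_notMem [DecidableEq R] [Fintype V] (w : R → V → A) (a : R)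
    {b : R} {P : Finset R} (hb : b ∉ P) : blockWeight (mergeWeight w a b) P = blockWeight w P := by
  simp only [blockWeight, fun v => prod_mergeWeight_of_notMem w a hb fun _ => v]

theorem blockWeight_insert [DecidableEq R] [Fintype V] (w : R → V → A) {a : R}
    {P : Finset R} (ha : a ∉ P) (hP : P.Nonempty) :
    blockWeight w (insert a P) = -∑ b ∈ P, blockWeight (mergeWeight w a b) P := by
  have hmerge : ∀ b ∈ P, blockWeight (mergeWeight w a b) P =
      (-1) ^ (#P - 1) * ((#P - 1).factorial : A) * ∑ v, w a v * ∏ r ∈ P, w r v := by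
    intro b hb
    simp only [blockWeight, fun v => prod_mergeWeight_of_mem w a hb fun _ => v]
  rw [sum_congr rfl hmerge, sum_const, blockWeight, card_insert_of_notMem ha]
  simp only [prod_insert ha, nsmul_eq_mul]
  obtain ⟨k, hk⟩ : ∃ k, #P = k + 1 := ⟨#P - 1, (Nat.sub_add_cancel hP.card_pos).symm⟩
  rw [hk, Nat.add_sub_cancel, Nat.add_sub_cancel, Nat.factorial_succ, pow_succ]
  push_cast
  ring

theorem sum_prod_blockWeight_insert [DecidableEq R] [Fintype V] (w : R → V → A) {a : R}
    {S : Finset R} (ha : a ∉ S) :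
    ∑ ρ : Finpartition (insert a S), ∏ P ∈ ρ.parts, blockWeight w P =
      (∑ v, w a v) * (∑ π : Finpartition S, ∏ P ∈ π.parts, blockWeight w P) -
        ∑ b ∈ S, ∑ π : Finpartition S, ∏ P ∈ π.parts, blockWeight (mergeWeight w a b) P := by
  rw [Finpartition.sum_prod_insert ha, sum_comm, mul_sum, ← sum_sub_distrib]
  refine sum_congr rfl fun π _ => ?_
  rw [blockWeight_singleton, sub_eq_add_neg]
  congr 1
  rw [← sum_congr π.biUnion_parts fun _ _ => rfl, sum_biUnion π.disjoint, ← sum_neg_distrib]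
  refine sum_congr rfl fun B hB => ?_
  rw [blockWeight_insert w (π.notMem_of_mem_parts ha hB) (π.nonempty_of_mem_parts hB), neg_mul,
    sum_mul]
  refine congrArg _ (sum_congr rfl fun b hb => ?_)
  rw [← mul_prod_erase _ _ hB]
  refine congrArg _ (prod_congr rfl fun P hP => ?_)
  refine (blockWeight_mergeWeight_of_notMem w a fun hbP => ne_of_mem_erase hP ?_).symm
  exact π.eq_of_mem_parts (mem_of_mem_erase hP) hB hbP hb

end BlockWeight

section Embeddings

variable {R V A : Type*} [CommRing A]

theorem sum_compl_range {α : Type*} [Fintype α] [Fintype V] [DecidableEq V] (f : α ↪ V)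
    (g : V → A) :
    ∑ v : ↥(Set.range f)ᶜ, g v = ∑ v, g v - ∑ x, g (f x) := by
  rw [eq_sub_iff_add_eq, add_comm, ← sum_map univ f g,
    ← sum_add_sum_compl (univ.map f) g]
  refine congrArg _ (sum_subtype _ (fun v => ?_) g).symm
  simp

theorem sum_embeddings_insert [DecidableEq R] [Fintype V] [DecidableEq V] (w : R → V → A)
    {a : R} {S : Finset R} (ha : a ∉ S) :
    ∑ f : ↥(insert a S) ↪ V, ∏ r : ↥(insert a S), w r (f r) =
      (∑ v, w a v) * (∑ f : S ↪ V, ∏ r : S, w r (f r)) -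
        ∑ b ∈ S, ∑ f : S ↪ V, ∏ r : S, mergeWeight w a b r (f r) := by
  let e := subtypeInsertEquivOption ha
  have hopt : ∑ f : ↥(insert a S) ↪ V, ∏ r : ↥(insert a S), w r (f r) =
      ∑ f : Option S ↪ V, w a (f none) * ∏ r : S, w r (f (some r)) := by
    refine Fintype.sum_equiv (Equiv.embeddingCongr e (Equiv.refl V)) _ _ fun f => ?_
    rw [Fintype.prod_equiv e _ (fun x => w (e.symm x) (f (e.symm x))) (by simp),
      Fintype.prod_option]
    rfl
  rw [hopt, Fintype.sum_equiv (Function.Embedding.optionEmbeddingEquiv S V)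
    (fun f => w a (f none) * ∏ r : S, w r (f (some r)))
    (fun x => w a x.2 * ∏ r : S, w r (x.1 r)) (fun _ => rfl), Fintype.sum_sigma, sum_comm,
    mul_sum, ← sum_sub_distrib]
  refine sum_congr rfl fun f _ => ?_
  dsimp only
  rw [← sum_mul, sum_compl_range f (w a), sub_mul, ← sum_coe_sort S,
    sum_mul (univ : Finset S)]
  refine congrArg _ (sum_congr rfl fun b _ => ?_)
  rw [← mul_prod_erase univ _ (mem_univ b), ← mul_prod_erase univ _ (mem_univ b)]
  simp only [mergeWeight, Function.update_self, Pi.mul_apply]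
  rw [← mul_assoc, mul_comm (w a _)]
  refine congrArg _ (prod_congr rfl fun r hr => ?_)
  rw [Function.update_of_ne (Subtype.coe_injective.ne (ne_of_mem_erase hr))]

theorem sum_embeddings_prod_eq_sum_finpartition [DecidableEq R] [Fintype V] [DecidableEq V]
    (S : Finset R) (w : R → V → A) :
    ∑ f : S ↪ V, ∏ r : S, w r (f r) =
      ∑ π : Finpartition S, ∏ P ∈ π.parts, blockWeight w P := by
  induction S using Finset.induction_on generalizing w with
  | empty =>
    have hparts (π : Finpartition (∅ : Finset R)) : π.parts = ∅ :=
      π.parts_eq_empty_iff.2 rfl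
    have hcard : Fintype.card (Finpartition (∅ : Finset R)) = 1 :=
      Fintype.card_eq_one_iff_nonempty_unique.2
        ⟨inferInstanceAs (Unique (Finpartition (⊥ : Finset R)))⟩
    simp [hparts, hcard]
  | insert a S ha ih =>
    rw [sum_embeddings_insert w ha, sum_prod_blockWeight_insert w ha, ih w]
    simp only [ih]

end Embeddings

theorem moebius_eq_prod {R : Type*} [Fintype R] [DecidableEq R]
    (π : Finpartition (univ : Finset R)) :
    moebius π = ∏ P ∈ π.parts, (-1) ^ (#P - 1) * ((#P - 1).factorial : ℤ) := by
  rw [prod_mul_distrib, prod_pow_eq_pow_sum, moebius,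
    sum_tsub_distrib _ fun P hP => (π.nonempty_of_mem_parts hP).card_pos, π.sum_card_parts,
    card_univ, ← card_eq_sum_ones]

/-- The monomial-symmetric/power-sum identity: the sum over injective maps
`f : R ↪ Fin n` of `∏_r y_{f r}^{λ r}` equals the Möbius-inverted sum over partitions
`π` of `R` of the products over parts `s` of the power sums `∑_v y_v^{∑_{r ∈ s} λ r}`. -/
theorem sum_embeddings_prod_pow_eq_moebius_sum {R : Type*} [Fintype R] [DecidableEq R]
    (lam : R → ℕ) (n : ℕ) :
    ∑ f : R ↪ Fin n, ∏ r : R, (X (f r) : MvPolynomial (Fin n) ℚ) ^ lam r =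
      ∑ π : Finpartition (univ : Finset R),
        moebius π • ∏ s ∈ π.parts,
          ∑ v : Fin n, (X v : MvPolynomial (Fin n) ℚ) ^ (∑ r ∈ s, lam r) := by
  let w : R → Fin n → MvPolynomial (Fin n) ℚ := fun r v => X v ^ lam r
  have huniv : ∑ f : R ↪ Fin n, ∏ r : R, w r (f r) =
      ∑ f : ↥(univ : Finset R) ↪ Fin n, ∏ r : ↥(univ : Finset R), w r (f r) := by
    let e : R ≃ ↥(univ : Finset R) := (Equiv.subtypeUnivEquiv mem_univ).symm
    refine Fintype.sum_equiv (Equiv.embeddingCongr e (Equiv.refl _)) _ _ fun f => ?_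
    exact Fintype.prod_equiv e _ _ fun r => by simp [e]
  refine huniv.trans ((sum_embeddings_prod_eq_sum_finpartition univ w).trans ?_)
  refine sum_congr rfl fun π _ => ?_
  rw [moebius_eq_prod, zsmul_eq_mul, Int.cast_prod, ← prod_mul_distrib]
  refine prod_congr rfl fun P _ => ?_
  simp [blockWeight, w, prod_pow_eq_pow_sum]
end
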